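/- (Fundamental Inequality II) Assume in addition to the accelerated primal-dual setting that θ₁ = 1 and 1/θ_{k+1} = (1 + √(1 + 4/θ_k²))/2 for all k ≥ 1, that there exists λ₂ > 0 with ⟨Bz, z⟩ ≥ λ₂‖z‖² for all z ∈ C^⊥, that T ≥ 2 is an integer, and that (1 − γL_f)I − (γτ/θ_k²)B ⪰ 0 for all 1 ≤ k ≤ T − 1. Then for every x ∈ C and every y ∈ C^⊥: Φ(u^T, y) − Φ(x, y) ≤ (1/T²) ( 2‖u¹ − x‖²/γ + 2‖y‖²/(τλ₂) ). -/

import Mathlib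

/-- Frobenius inner product on real m×d matrices. -/
noncomputable def ip {m d : ℕ} (x y : Matrix (Fin m) (Fin d) ℝ) : ℝ :=
  ∑ i, ∑ j, x i j * y i j

/-- The consensus subspace C = {1ₘ xᵀ : x ∈ ℝᵈ}. -/
def cC (m d : ℕ) : Set (Matrix (Fin m) (Fin d) ℝ) :=
  {x | ∃ v : Fin d → ℝ, ∀ i j, x i j = v j}

/-- The orthogonal complement C^⊥ = {y : 1ₘᵀ y = 0}. -/
def cPerp (m d : ℕ) : Set (Matrix (Fin m) (Fin d) ℝ) :=
  {y | ∀ j, ∑ i, y i j = 0}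

/-- The Lagrangian Φ(x, y) = f(x) + ⟨y, x⟩. -/
noncomputable def lagr {m d : ℕ} (f : Matrix (Fin m) (Fin d) ℝ → ℝ)
    (x y : Matrix (Fin m) (Fin d) ℝ) : ℝ :=
  f x + ip y x


section helpers
variable {m d : ℕ}

lemma ip_comm' (x y : Matrix (Fin m) (Fin d) ℝ) : ip x y = ip y x := by
  simp [ip, mul_comm]

lemma ip_add_l (x y z : Matrix (Fin m) (Fin d) ℝ) : ip (x + y) z = ip x z + ip y z := by
  simp [ip, add_mul, Finset.sum_add_distrib]

lemma ip_sub_l (x y z : Matrix (Fin m) (Fin d) ℝ) : ip (x - y) z = ip x z - ip y z := by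
  simp [ip, sub_mul, Finset.sum_sub_distrib]

lemma ip_smul_l (c : ℝ) (x z : Matrix (Fin m) (Fin d) ℝ) : ip (c • x) z = c * ip x z := by
  simp [ip, mul_assoc, Finset.mul_sum]

lemma ip_add_r (x y z : Matrix (Fin m) (Fin d) ℝ) : ip z (x + y) = ip z x + ip z y := by
  rw [ip_comm', ip_add_l, ip_comm' x, ip_comm' y]

lemma ip_sub_r (x y z : Matrix (Fin m) (Fin d) ℝ) : ip z (x - y) = ip z x - ip z y := by
  rw [ip_comm', ip_sub_l, ip_comm' x, ip_comm' y]

lemma ip_smul_r (c : ℝ) (x z : Matrix (Fin m) (Fin d) ℝ) : ip z (c • x) = c * ip z x := by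
  rw [ip_comm', ip_smul_l, ip_comm' x]

lemma ip_zero_l (z : Matrix (Fin m) (Fin d) ℝ) : ip 0 z = 0 := by
  simp [ip]

lemma ip_self_nonneg (z : Matrix (Fin m) (Fin d) ℝ) : 0 ≤ ip z z :=
  Finset.sum_nonneg fun _ _ => Finset.sum_nonneg fun _ _ => mul_self_nonneg _

lemma ip_self_eq_zero (z : Matrix (Fin m) (Fin d) ℝ) (h : ip z z ≤ 0) : z = 0 := by
  have h0 : ip z z = 0 := le_antisymm h (ip_self_nonneg z)
  ext i j
  have h1 := (Finset.sum_eq_zero_iff_of_nonneg (s := Finset.univ)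
    (f := fun i => ∑ j, z i j * z i j)
    (fun _ _ => Finset.sum_nonneg fun _ _ => mul_self_nonneg _)).mp h0 i (Finset.mem_univ _)
  have h2 := (Finset.sum_eq_zero_iff_of_nonneg (s := Finset.univ)
    (f := fun j => z i j * z i j)
    (fun _ _ => mul_self_nonneg _)).mp h1 j (Finset.mem_univ _)
  simpa using h2

lemma ip_eq_trace (x y : Matrix (Fin m) (Fin d) ℝ) : ip x y = (x.transpose * y).trace := by
  simp only [ip, Matrix.trace, Matrix.diag, Matrix.mul_apply, Matrix.transpose_apply]
  exact Finset.sum_comm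

lemma ip_mul_l (M : Matrix (Fin m) (Fin m) ℝ) (hM : M.transpose = M)
    (x y : Matrix (Fin m) (Fin d) ℝ) : ip (M * x) y = ip x (M * y) := by
  rw [ip_eq_trace, ip_eq_trace, Matrix.transpose_mul, hM, Matrix.mul_assoc]

lemma psd_symm {M : Matrix (Fin m) (Fin m) ℝ} (hM : M.PosSemidef) : M.transpose = M := by
  have := hM.1
  rwa [Matrix.IsHermitian, Matrix.conjTranspose_eq_transpose_of_trivial] at this

lemma psd_ip {M : Matrix (Fin m) (Fin m) ℝ} (hM : M.PosSemidef)
    (z : Matrix (Fin m) (Fin d) ℝ) : 0 ≤ ip (M * z) z := by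
  rw [ip_comm', ip_eq_trace, ← Matrix.mul_assoc,
    ← Matrix.conjTranspose_eq_transpose_of_trivial]
  exact (hM.conjTranspose_mul_mul_same z).trace_nonneg

lemma ip_C_perp {x y : Matrix (Fin m) (Fin d) ℝ} (hx : x ∈ cC m d) (hy : y ∈ cPerp m d) :
    ip y x = 0 := by
  obtain ⟨v, hv⟩ := hx
  unfold ip
  rw [Finset.sum_comm]
  refine Finset.sum_eq_zero fun j _ => ?_
  simp only [hv]
  rw [← Finset.sum_mul, hy j, zero_mul]

lemma mul_C {M : Matrix (Fin m) (Fin m) ℝ} (hM : M.mulVec (fun _ => (1 : ℝ)) = 0)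
    {x : Matrix (Fin m) (Fin d) ℝ} (hx : x ∈ cC m d) : M * x = 0 := by
  obtain ⟨v, hv⟩ := hx
  ext i j
  have := congrFun hM i
  simp only [Matrix.mulVec, dotProduct, mul_one, Pi.zero_apply] at this
  simp [Matrix.mul_apply, hv, ← Finset.sum_mul, this]

lemma mul_perp {M : Matrix (Fin m) (Fin m) ℝ} (hM : M.mulVec (fun _ => (1 : ℝ)) = 0)
    (hs : M.transpose = M) (z : Matrix (Fin m) (Fin d) ℝ) : M * z ∈ cPerp m d := by
  intro j
  simp only [Matrix.mul_apply]
  rw [Finset.sum_comm]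
  refine Finset.sum_eq_zero fun k _ => ?_
  rw [← Finset.sum_mul]
  have := congrFun hM k
  simp only [Matrix.mulVec, dotProduct, mul_one, Pi.zero_apply] at this
  have h2 : ∑ i, M i k = ∑ i, M k i :=
    Finset.sum_congr rfl fun i _ => by rw [← Matrix.transpose_apply M, hs]
  rw [h2, this, zero_mul]

lemma exists_preimage (B : Matrix (Fin m) (Fin m) ℝ) (hB : B.transpose = B)
    (hB1 : B.mulVec (fun _ => (1 : ℝ)) = 0) (lam2 : ℝ) (hlam2 : 0 < lam2)
    (hBlow : ∀ z ∈ cPerp m d, lam2 * ip z z ≤ ip (B * z) z)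
    (y : Matrix (Fin m) (Fin d) ℝ) (hy : y ∈ cPerp m d) :
    ∃ s : Matrix (Fin m) (Fin d) ℝ, B * s = y ∧ lam2 * ip (B * s) s ≤ ip y y := by
  let P : Submodule ℝ (Matrix (Fin m) (Fin d) ℝ) :=
    { carrier := cPerp m d
      add_mem' := fun {a b} ha hb j => by
        simp [Finset.sum_add_distrib, ha j, hb j]
      zero_mem' := fun j => by simp
      smul_mem' := fun c a ha j => by
        simp [← Finset.mul_sum, ha j] }
  let F : P →ₗ[ℝ] P :=
    { toFun := fun z => ⟨B * z.1, mul_perp hB1 hB z.1⟩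
      map_add' := fun a b => Subtype.ext (by simp [Matrix.mul_add])
      map_smul' := fun c a => Subtype.ext (by simp) }
  have hinj : Function.Injective F := by
    rw [← LinearMap.ker_eq_bot, LinearMap.ker_eq_bot']
    intro z hz
    have hz' : B * z.1 = 0 := congrArg Subtype.val hz
    have h1 := hBlow z.1 z.2
    rw [hz', ip_zero_l] at h1
    exact Subtype.ext (ip_self_eq_zero _ (by nlinarith [ip_self_nonneg z.1]))
  obtain ⟨s, hs⟩ := LinearMap.injective_iff_surjective.mp hinj ⟨y, hy⟩
  have hs' : B * s.1 = y := congrArg Subtype.val hs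
  refine ⟨s.1, hs', ?_⟩
  have h1 := hBlow s.1 s.2
  rw [hs'] at h1 ⊢
  have h2 := ip_self_nonneg (y - lam2 • s.1)
  simp only [ip_sub_l, ip_sub_r, ip_smul_l, ip_smul_r, ip_comm' s.1 y] at h2
  nlinarith

lemma grad_ineq (f : Matrix (Fin m) (Fin d) ℝ → ℝ)
    (gf : Matrix (Fin m) (Fin d) ℝ → Matrix (Fin m) (Fin d) ℝ)
    (hconv : ConvexOn ℝ Set.univ f)
    (hgrad : ∀ x v : Matrix (Fin m) (Fin d) ℝ,
      HasDerivAt (fun t : ℝ => f (x + t • v)) (ip (gf x) v) 0)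
    (x w : Matrix (Fin m) (Fin d) ℝ) : f x + ip (gf x) (w - x) ≤ f w := by
  have hc : ConvexOn ℝ Set.univ (fun t : ℝ => f (x + t • (w - x))) := by
    refine ⟨convex_univ, fun s _ t _ a b ha hb hab => ?_⟩
    have := hconv.2 (Set.mem_univ (x + s • (w - x))) (Set.mem_univ (x + t • (w - x))) ha hb hab
    refine le_trans (le_of_eq ?_) this
    show f _ = f _
    congr 1
    have hx : x = (a + b) • x := by rw [hab, one_smul]
    conv_lhs => rw [hx]
    simp only [smul_eq_mul]
    rw [← hx]
    nth_rewrite 1 [hx]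
    module
  have := hc.le_slope_of_hasDerivAt (Set.mem_univ 0) (Set.mem_univ 1) zero_lt_one
    (hgrad x (w - x))
  simp [slope_def_field] at this
  linarith

lemma form_psd (A : Matrix (Fin m) (Fin m) ℝ) (hA : A.PosSemidef)
    (hIA : ((1 : Matrix (Fin m) (Fin m) ℝ) - A).PosSemidef)
    (v : Matrix (Fin m) (Fin d) ℝ) : 0 ≤ ip (v - A * v) (A * v) := by
  have h1 := psd_ip hA (v - A * v)
  have h2 := psd_ip hIA (A * v)
  have e : ∀ p q : Matrix (Fin m) (Fin d) ℝ, ip (A * p) q = ip p (A * q) :=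
    ip_mul_l A (psd_symm hA)
  simp only [Matrix.sub_mul, Matrix.mul_sub, Matrix.one_mul, ip_sub_l, ip_sub_r, e] at h1 h2 ⊢
  linarith

lemma form_cross (A : Matrix (Fin m) (Fin m) ℝ) (hA : A.PosSemidef)
    (hIA : ((1 : Matrix (Fin m) (Fin m) ℝ) - A).PosSemidef)
    (v w : Matrix (Fin m) (Fin d) ℝ) :
    2 * ip (v - A * v) (A * w) ≤ ip (v - A * v) (A * v) + ip (w - A * w) (A * w) := by
  have h1 := form_psd A hA hIA (v - w)
  have e : ∀ p q : Matrix (Fin m) (Fin d) ℝ, ip (A * p) q = ip p (A * q) :=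
    ip_mul_l A (psd_symm hA)
  have c1 : ip w (A * v) = ip v (A * w) := by rw [← e, ip_comm']
  have c2 : ip w (A * (A * v)) = ip v (A * (A * w)) := by rw [← e, ← e, ip_comm']
  simp only [Matrix.mul_sub, ip_sub_l, ip_sub_r, e, c1, c2] at h1 ⊢
  linarith

lemma one_step (f : Matrix (Fin m) (Fin d) ℝ → ℝ) (B : Matrix (Fin m) (Fin m) ℝ)
    (hB : B.PosSemidef) (γ τ L a : ℝ) (hγ : 0 < γ) (hτ : 0 < τ) (ha : 1 ≤ a)
    (U U' X Z Z' V G Yh S S' s x : Matrix (Fin m) (Fin d) ℝ) (q : ℝ)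
    (hZ : Z = a • X - (a - 1) • U) (hZ' : Z' = a • U' - (a - 1) • U)
    (c1 : f X + ip G (U - X) ≤ f U) (c2 : f X + ip G (x - X) ≤ f x)
    (c3 : f U' ≤ f X + ip G (U' - X) + L / 2 * ip (U' - X) (U' - X))
    (hV : V = X - γ • (G + Yh)) (hYh : Yh = B * S + (τ * a) • (B * Z))
    (hS : S' = S + (τ * a) • Z') (hVx : ip (V - U') x = 0) (hBx : B * x = 0)
    (hq' : 0 ≤ ip (V - U') U')
    (hq : (a - 1) * (2 * ip (V - U') U) ≤ (a - 1) * (ip (V - U') U' + q))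
    (hpsd : 0 ≤ (1 - γ * L) * ip (Z' - Z) (Z' - Z) - γ * τ * a ^ 2 * ip (B * (Z' - Z)) (Z' - Z)) :
    a ^ 2 * (f U' + ip (B * s) U' - f x + 1 / (2 * γ) * ip (V - U') U')
      + 1 / (2 * γ) * ip (Z' - x) (Z' - x) + 1 / (2 * τ) * ip (B * (S' - s)) (S' - s)
    ≤ a * (a - 1) * (f U + ip (B * s) U - f x + 1 / (2 * γ) * q)
      + 1 / (2 * γ) * ip (Z - x) (Z - x) + 1 / (2 * τ) * ip (B * (S - s)) (S - s) := by
  have e : ∀ p q : Matrix (Fin m) (Fin d) ℝ, ip (B * p) q = ip p (B * q) :=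
    ip_mul_l B (psd_symm hB)
  have ex : ∀ p : Matrix (Fin m) (Fin d) ℝ, ip (B * p) x = 0 := fun p => by
    rw [e, hBx, ip_comm', ip_zero_l]
  have hD : Z' - Z = a • (U' - X) := by rw [hZ, hZ']; module
  -- (1)
  have p1 : a ^ 2 * (f U' - f x) ≤ a * (a - 1) * (f U - f x) + a * ip G (Z' - x)
      + L / 2 * ip (Z' - Z) (Z' - Z) := by
    rw [hD, hZ']
    simp only [ip_sub_l, ip_sub_r, ip_smul_l, ip_smul_r] at c1 c2 c3 ⊢
    have k1 := mul_le_mul_of_nonneg_left c1 (by nlinarith : 0 ≤ a * (a - 1))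
    have k2 := mul_le_mul_of_nonneg_left c2 (by linarith : 0 ≤ a)
    have k3 := mul_le_mul_of_nonneg_left c3 (by positivity : 0 ≤ a ^ 2)
    linarith
  -- (2)
  have p2 : a ^ 2 * ip (B * s) U' = a * (a - 1) * ip (B * s) U + a * ip (B * s) (Z' - x) := by
    rw [ip_sub_r, ex, hZ']
    simp only [ip_sub_r, ip_smul_r]
    ring
  -- (3)
  have p3 : γ * (a * ip (G + Yh) (Z' - x)) = - ip (Z' - Z) (Z' - x) - a * ip (V - U') Z' := by
    have h1 : γ • (G + Yh) = X - V := by rw [hV]; module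
    have h2 : a • (X - V) = - (1 : ℝ) • (Z' - Z) - a • (V - U') := by rw [hD]; module
    have h3 : γ * (a * ip (G + Yh) (Z' - x)) = ip (a • (γ • (G + Yh))) (Z' - x) := by
      rw [ip_smul_l, ip_smul_l]; ring
    rw [h3, h1, h2, ip_sub_l, ip_smul_l, ip_smul_l, ip_sub_r _ _ (V - U'), hVx]
    ring
  -- (4)
  have p4 : a ^ 2 / 2 * ip (V - U') U' - a * (a - 1) / 2 * q ≤ a * ip (V - U') Z' := by
    have : a * ip (V - U') Z' = a ^ 2 * ip (V - U') U' - a * (a - 1) * ip (V - U') U := by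
      rw [hZ', ip_sub_r, ip_smul_r, ip_smul_r]; ring
    rw [this]
    have k := mul_le_mul_of_nonneg_left hq (by linarith : 0 ≤ a / 2)
    have k2 : 0 ≤ a * ip (V - U') U' := mul_nonneg (by linarith) hq'
    nlinarith
  -- (5)
  have p5 : a * ip (B * s - Yh) (Z' - x) ≤ 1 / (2 * τ) * ip (B * (S - s)) (S - s)
      - 1 / (2 * τ) * ip (B * (S' - s)) (S' - s)
      + τ * a ^ 2 / 2 * ip (B * (Z' - Z)) (Z' - Z) := by
    have k := mul_nonneg (by positivity : 0 ≤ τ * a ^ 2 / 2) (psd_ip hB Z)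
    have g1 : ip Z' (B * S) = ip S (B * Z') := by rw [← e, ip_comm']
    have g2 : ip Z' (B * s) = ip s (B * Z') := by rw [← e, ip_comm']
    have g3 : ip Z' (B * Z) = ip Z (B * Z') := by rw [← e, ip_comm']
    have g4 : ip (B * s - Yh) x = 0 := by
      rw [hYh]; simp only [ip_sub_l, ip_add_l, ip_smul_l, ex]; ring
    rw [ip_sub_r, g4, hYh, hS]
    simp only [Matrix.mul_add, Matrix.mul_sub, Matrix.mul_smul, ip_sub_l, ip_sub_r, ip_add_l,
      ip_add_r, ip_smul_l, ip_smul_r, e, g1, g2, g3] at k ⊢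
    have hne : τ ≠ 0 := hτ.ne'
    rw [← sub_nonneg]
    refine le_of_le_of_eq k ?_
    field_simp
    have g5 : ip s (B * S) = ip S (B * s) := by rw [← e, ip_comm']
    rw [g5]
    ring
  have p6 : ip (Z' - Z) (Z' - x) = 1 / 2 * ip (Z' - x) (Z' - x) - 1 / 2 * ip (Z - x) (Z - x)
      + 1 / 2 * ip (Z' - Z) (Z' - Z) := by
    simp only [ip_sub_l, ip_sub_r, ip_comm' Z' Z, ip_comm' x Z, ip_comm' x Z']
    ring
  have p7 : a * ip G (Z' - x) + a * ip (B * s) (Z' - x)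
      = a * ip (G + Yh) (Z' - x) + a * ip (B * s - Yh) (Z' - x) := by
    rw [ip_add_l, ip_sub_l]; ring
  have p8 : a * ip (G + Yh) (Z' - x) ≤ 1 / γ * (- (1 / 2 * ip (Z' - x) (Z' - x)
      - 1 / 2 * ip (Z - x) (Z - x) + 1 / 2 * ip (Z' - Z) (Z' - Z))
      - (a ^ 2 / 2 * ip (V - U') U' - a * (a - 1) / 2 * q)) := by
    rw [one_div, le_inv_mul_iff₀ hγ, p3, p6]
    linarith
  have p9 : 0 ≤ 1 / (2 * γ) * ip (Z' - Z) (Z' - Z) - L / 2 * ip (Z' - Z) (Z' - Z)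
      - τ * a ^ 2 / 2 * ip (B * (Z' - Z)) (Z' - Z) := by
    have := mul_nonneg (by positivity : 0 ≤ 1 / (2 * γ)) hpsd
    refine le_of_le_of_eq this ?_
    field_simp
  have p10 : 1 / γ = 2 * (1 / (2 * γ)) := by field_simp
  rw [p10] at p8
  linarith

end helpers

/-- Fundamental Inequality II: with the Nesterov sequence θ_k
and the step-size positive-semidefiniteness condition, for every x ∈ C and
y ∈ C^⊥, Φ(u^T, y) − Φ(x, y) ≤ (1/T²)(2‖u¹ − x‖²/γ + 2‖y‖²/(τλ₂)). -/
theorem stmt_11 {m d : ℕ} (f : Matrix (Fin m) (Fin d) ℝ → ℝ)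
    (gf : Matrix (Fin m) (Fin d) ℝ → Matrix (Fin m) (Fin d) ℝ)
    (L_f : ℝ) (hLf : 0 < L_f)
    (hconv : ConvexOn ℝ Set.univ f)
    (hgrad : ∀ x v : Matrix (Fin m) (Fin d) ℝ,
      HasDerivAt (fun t : ℝ => f (x + t • v)) (ip (gf x) v) 0)
    (hsmooth : ∀ z w : Matrix (Fin m) (Fin d) ℝ,
      f w ≤ f z + ip (gf z) (w - z) + L_f / 2 * ip (w - z) (w - z))
    (A B : Matrix (Fin m) (Fin m) ℝ)
    (hA : A.PosSemidef) (hIA : ((1 : Matrix (Fin m) (Fin m) ℝ) - A).PosSemidef)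
    (hA1 : ((1 : Matrix (Fin m) (Fin m) ℝ) - A).mulVec (fun _ => (1 : ℝ)) = 0)
    (hB : B.PosSemidef) (hB1 : B.mulVec (fun _ => (1 : ℝ)) = 0)
    (γ τ : ℝ) (hγ : 0 < γ) (hτ : 0 < τ)
    (θ : ℕ → ℝ) (hθ : ∀ k ≥ 1, 0 < θ k ∧ θ k ≤ 1) (hθ1 : θ 1 = 1)
    (hθrec : ∀ k ≥ 1, 1 / θ (k + 1) = (1 + Real.sqrt (1 + 4 / θ k ^ 2)) / 2)
    (lam2 : ℝ) (hlam2 : 0 < lam2)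
    (hBlow : ∀ z ∈ cPerp m d, lam2 * ip z z ≤ ip (B * z) z)
    (T : ℕ) (hT : 2 ≤ T)
    (hPSD : ∀ k, 1 ≤ k → k ≤ T - 1 →
      ((1 - γ * L_f) • (1 : Matrix (Fin m) (Fin m) ℝ)
        - (γ * τ / θ k ^ 2) • B).PosSemidef)
    (u uh x xh y yh : ℕ → Matrix (Fin m) (Fin d) ℝ)
    (hu1 : u 1 = x 1) (hxh1 : xh 1 = x 1) (hy1 : y 1 = 0)
    (hyh1 : yh 1 = τ • (B * x 1))
    (huh : ∀ k ≥ 1, uh k = x k - γ • (gf (x k) + yh k))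
    (hu : ∀ k ≥ 1, u (k + 1) = A * uh k)
    (hx : ∀ k ≥ 1, x (k + 1) =
      u (k + 1) + (θ (k + 1) / θ k - θ (k + 1)) • (u (k + 1) - u k))
    (hxh : ∀ k ≥ 1, xh (k + 1) =
      (1 / θ (k + 1)) • x (k + 1) + (1 - 1 / θ (k + 1)) • u (k + 1))
    (hy : ∀ k ≥ 1, y (k + 1) = y k + (τ / θ k) • (B * xh (k + 1)))
    (hyh : ∀ k ≥ 1, yh (k + 1) = y (k + 1) + (θ k / θ (k + 1)) • (y (k + 1) - y k)) :
    ∀ xx ∈ cC m d, ∀ yy ∈ cPerp m d,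
      lagr f (u T) yy - lagr f xx yy ≤
        (1 / (T : ℝ) ^ 2) *
          (2 * ip (u 1 - xx) (u 1 - xx) / γ + 2 * ip yy yy / (τ * lam2)) := by
  intro xx hxx yy hyy
  have hBs := psd_symm hB
  obtain ⟨s, hs, hsl⟩ := exists_preimage B hBs hB1 lam2 hlam2 hBlow yy hyy
  have hBx : B * xx = 0 := mul_C hB1 hxx
  have hIAs := psd_symm hIA
  have hgi := grad_ineq f gf hconv hgrad
  have hθne : ∀ k ≥ 1, θ k ≠ 0 := fun k hk => (hθ k hk).1.ne'
  have ha1 : ∀ k ≥ 1, 1 ≤ 1 / θ k := fun k hk => by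
    rw [le_div_iff₀ (hθ k hk).1]; linarith [(hθ k hk).2]
  have harec : ∀ k ≥ 1, 1 / θ (k + 1) * (1 / θ (k + 1) - 1) = (1 / θ k) ^ 2 := by
    intro k hk
    rw [hθrec k hk]
    have h := Real.sq_sqrt (by positivity : 0 ≤ 1 + 4 / θ k ^ 2)
    have h2 : (1 / θ k) ^ 2 = 1 / 4 * (4 / θ k ^ 2) := by ring
    rw [h2]
    nlinarith
  have halow : ∀ k : ℕ, k ≥ 1 → ((k : ℝ) + 1) / 2 ≤ 1 / θ k := by
    intro k hk
    induction k, hk using Nat.le_induction with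
    | base => rw [hθ1]; norm_num
    | succ k hk ih =>
      have h1 := harec k hk
      have h2 := ha1 (k + 1) (by omega)
      have h3 := ha1 k hk
      push_cast
      nlinarith
  -- structural identities
  have hZ' : ∀ k ≥ 1, xh (k + 1) = (1 / θ k) • u (k + 1) - (1 / θ k - 1) • u k := by
    intro k hk
    have hn := hθne (k + 1) (by omega)
    rw [hxh k hk, hx k hk]
    have h : (1 / θ (k + 1)) * (θ (k + 1) / θ k - θ (k + 1)) = 1 / θ k - 1 := by
      have := hθne k hk
      field_simp
    rw [smul_add, smul_smul, h]
    module
  have hZ : ∀ k ≥ 1, xh k = (1 / θ k) • x k - (1 / θ k - 1) • u k := by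
    intro k hk
    rcases Nat.lt_or_ge 1 k with h | h
    · obtain ⟨j, rfl⟩ : ∃ j, k = j + 1 := ⟨k - 1, by omega⟩
      rw [hxh j (by omega)]
      module
    · obtain rfl : k = 1 := by omega
      rw [hxh1, hu1, hθ1]
      module
  have hYh : ∀ k ≥ 1, yh k = y k + (τ * (1 / θ k)) • (B * xh k) := by
    intro k hk
    rcases Nat.lt_or_ge 1 k with h | h
    · obtain ⟨j, rfl⟩ : ∃ j, k = j + 1 := ⟨k - 1, by omega⟩
      have hj : j ≥ 1 := by omega
      have h1 : y (j + 1) - y j = (τ / θ j) • (B * xh (j + 1)) := by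
        rw [hy j hj]; abel
      rw [hyh j hj, h1, smul_smul]
      congr 2
      have := hθne j hj
      have := hθne (j + 1) (by omega)
      field_simp
    · obtain rfl : k = 1 := by omega
      rw [hyh1, hy1, hxh1, hθ1]
      simp
  have hVx : ∀ k ≥ 1, ip (uh k - u (k + 1)) xx = 0 := by
    intro k hk
    have : uh k - u (k + 1) = (1 - A) * uh k := by
      rw [hu k hk, Matrix.sub_mul, Matrix.one_mul]
    rw [this, ip_mul_l _ hIAs, mul_C hA1 hxx, ip_comm', ip_zero_l]
  have hq' : ∀ k ≥ 1, 0 ≤ ip (uh k - u (k + 1)) (u (k + 1)) := by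
    intro k hk
    rw [hu k hk]
    exact form_psd A hA hIA _
  -- one step
  have step : ∀ k ≥ 1, k ≤ T - 1 → ∀ (S : Matrix (Fin m) (Fin d) ℝ) (q : ℝ), y k = B * S →
      (1 / θ k - 1) * (2 * ip (uh k - u (k + 1)) (u k))
        ≤ (1 / θ k - 1) * (ip (uh k - u (k + 1)) (u (k + 1)) + q) → _ :=
    fun k hk hkT S q hS hq =>
      one_step f B hB γ τ L_f (1 / θ k) hγ hτ (ha1 k hk) (u k) (u (k + 1)) (x k) (xh k)
        (xh (k + 1)) (uh k) (gf (x k)) (yh k) S (S + (τ * (1 / θ k)) • xh (k + 1)) s xx q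
        (hZ k hk) (hZ' k hk) (hgi _ _) (hgi _ _) (hsmooth _ _) (huh k hk)
        (by rw [hYh k hk, hS]) rfl (hVx k hk) hBx (hq' k hk) hq
        (by
          have := psd_ip (hPSD k hk hkT) (xh (k + 1) - xh k)
          rw [Matrix.sub_mul, Matrix.smul_mul, Matrix.smul_mul, Matrix.one_mul, ip_sub_l,
            ip_smul_l, ip_smul_l] at this
          refine le_of_le_of_eq this ?_
          ring)
  have hyS : ∀ k ≥ 1, ∀ S, y k = B * S → y (k + 1) = B * (S + (τ * (1 / θ k)) • xh (k + 1)) := by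
    intro k hk S hS
    rw [hy k hk, hS, Matrix.mul_add, Matrix.mul_smul]
    congr 2
    ring
  have inv : ∀ k ≥ 1, k ≤ T - 1 → ∃ S : Matrix (Fin m) (Fin d) ℝ, y (k + 1) = B * S ∧
      (1 / θ k) ^ 2 * (f (u (k + 1)) + ip (B * s) (u (k + 1)) - f xx
        + 1 / (2 * γ) * ip (uh k - u (k + 1)) (u (k + 1)))
      + 1 / (2 * γ) * ip (xh (k + 1) - xx) (xh (k + 1) - xx)
      + 1 / (2 * τ) * ip (B * (S - s)) (S - s)
      ≤ 1 / (2 * γ) * ip (u 1 - xx) (u 1 - xx) + 1 / (2 * τ) * ip (B * s) s := by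
    intro k hk
    induction k, hk using Nat.le_induction with
    | base =>
      intro hkT
      have h0 : y 1 = B * (0 : Matrix (Fin m) (Fin d) ℝ) := by rw [hy1, Matrix.mul_zero]
      refine ⟨_, hyS 1 le_rfl 0 h0, ?_⟩
      have := step 1 le_rfl hkT 0 0 h0 (by rw [hθ1]; simp)
      refine this.trans (le_of_eq ?_)
      have e0 : ip (B * (0 - s)) (0 - s) = ip (B * s) s := by
        simp only [Matrix.mul_sub, Matrix.mul_zero, ip_sub_l, ip_sub_r, ip_zero_l,
          ip_comm' _ (0 : Matrix (Fin m) (Fin d) ℝ)]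
        ring
      rw [e0, hθ1, hxh1, hu1]
      ring
    | succ k hk ih =>
      intro hkT
      obtain ⟨S, hS, hI⟩ := ih (by omega)
      refine ⟨_, hyS (k + 1) (by omega) S hS, ?_⟩
      have := step (k + 1) (by omega) hkT S (ip (uh k - u (k + 1)) (u (k + 1))) hS
        (mul_le_mul_of_nonneg_left (by
          rw [hu (k + 1) (by omega), hu k hk]
          exact form_cross A hA hIA _ _) (by linarith [ha1 (k + 1) (by omega)]))
      refine this.trans ?_
      rw [harec k hk]
      exact hI
  obtain ⟨n, rfl⟩ : ∃ n, T = n + 1 := ⟨T - 1, by omega⟩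
  have hn : n ≥ 1 := by omega
  obtain ⟨S, -, hI⟩ := inv n hn (by omega)
  have r1 := mul_nonneg (by positivity : 0 ≤ 1 / (2 * γ)) (ip_self_nonneg (xh (n + 1) - xx))
  have r2 := mul_nonneg (by positivity : 0 ≤ 1 / (2 * τ)) (psd_ip hB (S - s))
  have r3 := mul_nonneg (by positivity : 0 ≤ (1 / θ n) ^ 2 * (1 / (2 * γ))) (hq' n hn)
  have r4 : 1 / (2 * τ) * ip (B * s) s ≤ 1 / (2 * τ) * (ip yy yy / lam2) := by
    refine mul_le_mul_of_nonneg_left ?_ (by positivity)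
    rw [le_div_iff₀ hlam2]
    linarith
  have hl : lagr f (u (n + 1)) yy - lagr f xx yy
      = f (u (n + 1)) + ip (B * s) (u (n + 1)) - f xx := by
    unfold lagr
    rw [ip_C_perp hxx hyy, hs]; ring
  rw [hl]
  set E := f (u (n + 1)) + ip (B * s) (u (n + 1)) - f xx with hE
  have hR : 0 ≤ 1 / (2 * γ) * ip (u 1 - xx) (u 1 - xx) + 1 / (2 * τ) * (ip yy yy / lam2) := by
    have := ip_self_nonneg (u 1 - xx)
    have := ip_self_nonneg yy
    positivity
  have hEm : (1 / θ n) ^ 2 * E ≤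
      1 / (2 * γ) * ip (u 1 - xx) (u 1 - xx) + 1 / (2 * τ) * (ip yy yy / lam2) := by
    linarith
  have hal := halow n hn
  have hfin : ((n : ℝ) + 1) ^ 2 / 4 * E ≤
      1 / (2 * γ) * ip (u 1 - xx) (u 1 - xx) + 1 / (2 * τ) * (ip yy yy / lam2) := by
    rcases le_total E 0 with h | h
    · refine le_trans ?_ hR
      exact mul_nonpos_of_nonneg_of_nonpos (by positivity) h
    · refine le_trans (mul_le_mul_of_nonneg_right ?_ h) hEm
      have : (((n : ℝ) + 1) / 2) ^ 2 ≤ (1 / θ n) ^ 2 := pow_le_pow_left₀ (by positivity) hal 2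
      linarith
  push_cast
  rw [one_div_mul_eq_div, le_div_iff₀ (by positivity)]
  have hRR : 2 * ip (u 1 - xx) (u 1 - xx) / γ + 2 * ip yy yy / (τ * lam2)
      = 4 * (1 / (2 * γ) * ip (u 1 - xx) (u 1 - xx) + 1 / (2 * τ) * (ip yy yy / lam2)) := by
    field_simp
    ring
  rw [hRR]
  linarith
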